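/- Let (R, 𝔪) be a commutative Noetherian local ring, r ≥ 1 an integer, I_1,…,I_r ideals of R, and N ⊆ M finitely generated R-modules. Let f : K → L be an R-linear map between finitely generated R-modules and let F denote the associated coherent functor, F(X) := Hom_R(K,X) / {g ∘ f : g ∈ Hom_R(L,X)}. Then the injective dimension of F(M/I^n N) is eventually constant: there exists c ∈ ℕ^r such that for all n ≥ c, id_R(F(M/I^n N)) = id_R(F(M/I^c N)) as elements of ℕ ∪ {∞}. -/

import Mathlib

universe u

open CategoryTheory

/-- The value of the coherent functor presented by `f : K →ₗ[R] L` on a module `X`: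
`F(X) = Hom_R(K, X) / {g ∘ f : g ∈ Hom_R(L, X)}`. -/
abbrev coherentApply {R K L : Type u} [CommRing R] [AddCommGroup K] [Module R K]
    [AddCommGroup L] [Module R L] (f : K →ₗ[R] L)
    (X : Type u) [AddCommGroup X] [Module R X] : Type u :=
  (K →ₗ[R] X) ⧸ LinearMap.range (LinearMap.lcomp R X f)

/-- The product ideal `I^n = I_1^{n_1} ⋯ I_r^{n_r}`. -/
abbrev prodPow {R : Type u} [CommRing R] {r : ℕ} (I : Fin r → Ideal R)
    (n : Fin r → ℕ) : Ideal R :=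
  ∏ i, I i ^ n i

/-- The injective dimension `id_R(X) ∈ ℕ ∪ {∞}` of an `R`-module `X`: the least
`m ∈ ℕ` such that `Ext_R^{m+1}(Y, X) = 0` for every `R`-module `Y` (equivalently, the
least length of an injective resolution of `X`), and `⊤` if there is no such `m`. -/
noncomputable def injDim (R : Type u) [CommRing R]
    (X : Type u) [AddCommGroup X] [Module R X] : ℕ∞ :=
  sInf {n : ℕ∞ | ∃ m : ℕ, n = m ∧ ∀ Y : ModuleCat.{u} R,
    Subsingleton ↥(((Ext R (ModuleCat.{u} R) (m + 1)).obj
      (Opposite.op Y)).obj (ModuleCat.of R X))}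


section ArtinRees

variable {R : Type u} [CommRing R] {r : ℕ}

lemma prodPow_add (I : Fin r → Ideal R) (a b : Fin r → ℕ) :
    prodPow I (a + b) = prodPow I a * prodPow I b := by
  simp [prodPow, pow_add, Finset.prod_mul_distrib]

lemma prodPow_le (I : Fin r → Ideal R) {a b : Fin r → ℕ} (h : a ≤ b) :
    prodPow I b ≤ prodPow I a := by
  rw [← tsub_add_cancel_of_le h, prodPow_add]
  exact Ideal.mul_le_right (I := prodPow I (b - a)) (J := prodPow I a)

lemma prodPow_single (I : Fin r → Ideal R) (i : Fin r) :
    prodPow I (Pi.single i 1) = I i := by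
  classical
  unfold prodPow
  rw [Finset.prod_eq_single i]
  · simp
  · intro j _ hj
    simp [Pi.single_eq_of_ne hj]
  · simp

lemma prodPow_zero (I : Fin r → Ideal R) : prodPow I 0 = ⊤ := by
  simp [prodPow]

section

variable {σ : Type u} (w : σ → Fin r → ℕ) (x : σ → R)

open Classical in
lemma comp_monomial_mul (n : Fin r → ℕ) (d : σ →₀ ℕ) (a : R) (q : MvPolynomial σ R) :
    MvPolynomial.weightedHomogeneousComponent w n (MvPolynomial.monomial d a * q) =
      if Finsupp.weight w d ≤ n then MvPolynomial.monomial d a *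
        MvPolynomial.weightedHomogeneousComponent w (n - Finsupp.weight w d) q else 0 := by
  induction q using MvPolynomial.induction_on' with
  | monomial d' b =>
    have h1 : MvPolynomial.IsWeightedHomogeneous w (MvPolynomial.monomial d a) (Finsupp.weight w d) :=
      MvPolynomial.isWeightedHomogeneous_monomial w d a rfl
    have h2 : MvPolynomial.IsWeightedHomogeneous w (MvPolynomial.monomial d' b)
        (Finsupp.weight w d') :=
      MvPolynomial.isWeightedHomogeneous_monomial w d' b rfl
    rw [MvPolynomial.weightedHomogeneousComponent_of_mem (h1.mul h2),
      MvPolynomial.weightedHomogeneousComponent_of_mem h2]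
    by_cases h : Finsupp.weight w d ≤ n
    · rw [if_pos h]
      have : n = Finsupp.weight w d + Finsupp.weight w d' ↔
          n - Finsupp.weight w d = Finsupp.weight w d' := by
        rw [tsub_eq_iff_eq_add_of_le h, add_comm]
      by_cases h' : n = Finsupp.weight w d + Finsupp.weight w d'
      · rw [if_pos h', if_pos (this.1 h')]
      · rw [if_neg h', if_neg (fun h => h' (this.2 h)), mul_zero]
    · rw [if_neg h, if_neg]
      rintro rfl
      exact h (le_add_of_nonneg_right zero_le)
  | add p q hp hq =>
    rw [mul_add, map_add, hp, hq]
    split_ifs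
    · rw [map_add, mul_add]
    · simp

lemma eval_monomial_mem (I : Fin r → Ideal R) (hx : ∀ s, x s ∈ prodPow I (w s)) (d : σ →₀ ℕ)
    (a : R) :
    MvPolynomial.eval x (MvPolynomial.monomial d a) ∈ prodPow I (Finsupp.weight w d) := by
  have : MvPolynomial.eval x (MvPolynomial.monomial d 1) ∈ prodPow I (Finsupp.weight w d) := by
    induction d using Finsupp.induction_linear with
    | zero => simp [prodPow_zero]
    | add d d' h h' =>
      rw [map_add, prodPow_add, ← one_mul (1 : R), ← MvPolynomial.monomial_mul, map_mul]
      exact Ideal.mul_mem_mul h h'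
    | single s k =>
      simp only [MvPolynomial.eval_monomial, one_mul, pow_zero, Finsupp.prod_single_index,
        Finsupp.weight_single]
      induction k with
      | zero => simp [prodPow_zero]
      | succ k ih =>
        rw [pow_succ, succ_nsmul, prodPow_add]
        exact Ideal.mul_mem_mul ih (hx s)
  have h2 : MvPolynomial.eval x (MvPolynomial.monomial d a) =
      a * MvPolynomial.eval x (MvPolynomial.monomial d 1) := by
    simp [MvPolynomial.eval_monomial]
  rw [h2]
  exact Ideal.mul_mem_left _ _ this

lemma eval_homog_mem (I : Fin r → Ideal R) (hx : ∀ s, x s ∈ prodPow I (w s)) (n : Fin r → ℕ)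
    (p : MvPolynomial σ R) (hp : p.IsWeightedHomogeneous w n) :
    MvPolynomial.eval x p ∈ prodPow I n := by
  rw [p.as_sum, map_sum]
  refine Ideal.sum_mem _ fun d hd => ?_
  rw [← hp (MvPolynomial.mem_support_iff.1 hd)]
  exact eval_monomial_mem w x I hx d _

/-- The ideal of values of weighted homogeneous polynomials. -/
noncomputable def homogVal (n : Fin r → ℕ) : Ideal R :=
  Submodule.map (MvPolynomial.aeval x : MvPolynomial σ R →ₐ[R] R).toLinearMap
    (MvPolynomial.weightedHomogeneousSubmodule R w n)

lemma mem_homogVal (n : Fin r → ℕ) (z : R) : z ∈ homogVal w x n ↔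
    ∃ p : MvPolynomial σ R, p.IsWeightedHomogeneous w n ∧ MvPolynomial.eval x p = z := by
  simp [homogVal, Submodule.mem_map]

lemma homogVal_mul (a b : Fin r → ℕ) :
    homogVal w x a * homogVal w x b ≤ homogVal w x (a + b) := by
  rw [Ideal.mul_le]
  intro z hz z' hz'
  rw [mem_homogVal] at *
  obtain ⟨p, hp, rfl⟩ := hz
  obtain ⟨q, hq, rfl⟩ := hz'
  exact ⟨p * q, hp.mul hq, by simp⟩

lemma homogVal_zero : homogVal w x 0 = ⊤ := by
  rw [Ideal.eq_top_iff_one, mem_homogVal]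
  exact ⟨1, MvPolynomial.isWeightedHomogeneous_one R w, by simp⟩

lemma prodPow_le_homogVal (I : Fin r → Ideal R) (h : ∀ i, I i ≤ homogVal w x (Pi.single i 1))
    (n : Fin r → ℕ) : prodPow I n ≤ homogVal w x n := by
  have h1 : ∀ i (k : ℕ), I i ^ k ≤ homogVal w x (Pi.single i k) := by
    intro i k
    induction k with
    | zero => simp [homogVal_zero]
    | succ k ih =>
      rw [pow_succ, Pi.single_add]
      exact (Ideal.mul_mono ih (h i)).trans (homogVal_mul w x _ _)
  have h2 : ∀ s : Finset (Fin r), ∏ i ∈ s, I i ^ n i ≤ homogVal w x (∑ i ∈ s, Pi.single i (n i)) := by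
    classical
    intro s
    induction s using Finset.induction_on with
    | empty => simp [homogVal_zero]
    | insert i s hi ih =>
      rw [Finset.prod_insert hi, Finset.sum_insert hi]
      exact (Ideal.mul_mono (h1 _ _) ih).trans (homogVal_mul w x _ _)
  have := h2 Finset.univ
  rwa [Finset.univ_sum_single] at this

variable {T : Type u} [AddCommGroup T] [Module R T]

/-- Evaluation of the degree `n` part of a vector of polynomials. -/
noncomputable def thetaMap {g : ℕ} (y : Fin g → T) (n : Fin r → ℕ) :
    (Fin g → MvPolynomial σ R) →ₗ[R] T :=
  ∑ j, (LinearMap.toSpanSingleton R T (y j)) ∘ₗ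
    (MvPolynomial.aeval x : MvPolynomial σ R →ₐ[R] R).toLinearMap ∘ₗ
    MvPolynomial.weightedHomogeneousComponent w n ∘ₗ LinearMap.proj j

lemma thetaMap_apply {g : ℕ} (y : Fin g → T) (n : Fin r → ℕ) (p : Fin g → MvPolynomial σ R) :
    thetaMap w x y n p =
      ∑ j, MvPolynomial.eval x (MvPolynomial.weightedHomogeneousComponent w n (p j)) • y j := by
  simp [thetaMap]

open Classical in
lemma thetaMap_monomial_smul {g : ℕ} (y : Fin g → T) (n : Fin r → ℕ)
    (p : Fin g → MvPolynomial σ R) (d : σ →₀ ℕ) (a : R) :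
    thetaMap w x y n (MvPolynomial.monomial d a • p) =
      if Finsupp.weight w d ≤ n then MvPolynomial.eval x (MvPolynomial.monomial d a) •
        thetaMap w x y (n - Finsupp.weight w d) p else 0 := by
  simp only [thetaMap_apply, Pi.smul_apply, smul_eq_mul, comp_monomial_mul]
  split_ifs
  · simp only [map_mul, Finset.smul_sum, mul_smul]
  · simp

end

/-- Artin–Rees for several ideals. -/
lemma multiAR [IsNoetherianRing R] (I : Fin r → Ideal R) {T : Type u} [AddCommGroup T] [Module R T]
    [Module.Finite R T] (D N : Submodule R T) :
    ∃ c : Fin r → ℕ, ∀ n, c ≤ n →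
      D ⊓ prodPow I n • N ≤ prodPow I (n - c) • (D ⊓ prodPow I c • N) := by
  classical
  choose s hs using fun i => (IsNoetherian.noetherian (I i))
  let σ : Type u := Σ i : ULift.{u} (Fin r), {z // z ∈ s i.down}
  let w : σ → Fin r → ℕ := fun a => Pi.single a.1.down 1
  let x : σ → R := fun a => a.2.1
  have hx : ∀ a, x a ∈ prodPow I (w a) := by
    intro a
    simp only [w, prodPow_single]
    rw [← hs]
    exact Submodule.subset_span a.2.2
  have hI : ∀ i, I i ≤ homogVal w x (Pi.single i 1) := by
    intro i
    conv_lhs => rw [← hs i]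
    refine Submodule.span_le.2 fun z hz => ?_
    refine (mem_homogVal w x _ z).2 ⟨MvPolynomial.X (⟨⟨i⟩, ⟨z, hz⟩⟩ : σ), ?_, by simp [x]⟩
    exact MvPolynomial.isWeightedHomogeneous_X R w _
  obtain ⟨g, y, hy⟩ := Submodule.fg_iff_exists_fin_generating_family.1 (IsNoetherian.noetherian N)
  let θ := thetaMap w x y
  let E : (Fin r → ℕ) → Submodule R T := fun n => D ⊓ prodPow I n • N
  have hθN : ∀ n p, θ n p ∈ prodPow I n • N := by
    intro n p
    simp only [θ, thetaMap_apply]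
    refine Submodule.sum_mem _ fun j _ => Submodule.smul_mem_smul ?_ ?_
    · exact eval_homog_mem w x I hx n _
        (MvPolynomial.weightedHomogeneousComponent_isWeightedHomogeneous n _)
    · rw [← hy]
      exact Submodule.subset_span ⟨j, rfl⟩
  let 𝓓 : Submodule (MvPolynomial σ R) (Fin g → MvPolynomial σ R) :=
    { carrier := {p | ∀ n, θ n p ∈ D}
      add_mem' := fun {a b} ha hb n => by
        rw [map_add]; exact D.add_mem (ha n) (hb n)
      zero_mem' := fun n => by rw [map_zero]; exact D.zero_mem
      smul_mem' := fun c p hp => by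
        induction c using MvPolynomial.induction_on' with
        | monomial d a =>
          intro n
          simp only [θ, thetaMap_monomial_smul]
          split_ifs
          · exact D.smul_mem _ (hp _)
          · exact D.zero_mem
        | add a b ha hb =>
          intro n
          rw [add_smul, map_add]
          exact D.add_mem (ha n) (hb n) }
  obtain ⟨G, hG⟩ := IsNoetherian.noetherian 𝓓
  let c : Fin r → ℕ := G.sup fun P => Finset.univ.sup fun j =>
    MvPolynomial.weightedTotalDegree w (P j)
  refine ⟨c, fun n hn => ?_⟩
  have hc : ∀ P ∈ G, ∀ n, ¬ n ≤ c → θ n P = 0 := by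
    intro P hP n hnc
    simp only [θ, thetaMap_apply]
    refine Finset.sum_eq_zero fun j _ => ?_
    rw [MvPolynomial.weightedHomogeneousComponent_eq_zero', map_zero, zero_smul]
    rintro d hd rfl
    refine hnc ((MvPolynomial.le_weightedTotalDegree w hd).trans ?_)
    exact (Finset.le_sup (f := fun j => MvPolynomial.weightedTotalDegree w (P j))
      (Finset.mem_univ j)).trans (Finset.le_sup (f := fun P => Finset.univ.sup fun j =>
      MvPolynomial.weightedTotalDegree w (P j)) hP)
  let A : (Fin r → ℕ) → Submodule R T := fun n =>
    ⨆ e : {e : Fin r → ℕ // e ≤ c ∧ e ≤ n}, prodPow I (n - e.1) • E e.1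
  have hA : ∀ P ∈ Submodule.span (MvPolynomial σ R) (G : Set _), ∀ n, θ n P ∈ A n := by
    intro P hP
    induction hP using Submodule.span_induction with
    | mem P hP =>
      intro n
      by_cases h : n ≤ c
      · refine Submodule.mem_iSup_of_mem ⟨n, h, le_rfl⟩ ?_
        have h1 : P ∈ 𝓓 := hG ▸ Submodule.subset_span hP
        simp only [tsub_self, prodPow_zero, Submodule.top_smul]
        exact ⟨h1 n, hθN n P⟩
      · rw [hc P hP n h]; exact Submodule.zero_mem _
    | zero => intro n; rw [map_zero]; exact Submodule.zero_mem _
    | add P Q _ _ hP hQ =>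
      intro n; rw [map_add]; exact Submodule.add_mem _ (hP n) (hQ n)
    | smul a P _ hP =>
      induction a using MvPolynomial.induction_on' with
      | monomial d a =>
        intro n
        simp only [θ, thetaMap_monomial_smul]
        split_ifs with hd
        · have h1 := eval_monomial_mem w x I hx d a
          have h2 := Submodule.smul_mem_smul h1 (hP (n - Finsupp.weight w d))
          refine (?_ : prodPow I (Finsupp.weight w d) • A (n - Finsupp.weight w d) ≤ A n) h2
          simp only [A, Submodule.smul_iSup]
          refine iSup_le fun e => ?_
          rw [← Submodule.mul_smul, ← prodPow_add]
          have h3 : e.1 + Finsupp.weight w d ≤ n := by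
            have := add_le_add_left e.2.2 (Finsupp.weight w d)
            rwa [tsub_add_cancel_of_le hd] at this
          have h4 : e.1 ≤ n := (le_add_of_nonneg_right zero_le).trans h3
          refine le_trans (le_of_eq ?_) (le_iSup (fun e : {e : Fin r → ℕ // e ≤ c ∧ e ≤ n} =>
            prodPow I (n - e.1) • E e.1) ⟨e.1, e.2.1, h4⟩)
          congr 2
          funext i
          have := h3 i
          simp only [Pi.add_apply, Pi.sub_apply] at this ⊢
          omega
        · exact Submodule.zero_mem _
      | add a b ha hb =>
        intro n
        rw [add_smul, map_add]
        exact Submodule.add_mem _ (ha n) (hb n)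
  have hAn : A n ≤ prodPow I (n - c) • E c := by
    refine iSup_le fun e => ?_
    have : n - e.1 = (n - c) + (c - e.1) := by
      funext i
      have h1 : e.1 i ≤ c i := e.2.1 i
      have h2 : c i ≤ n i := hn i
      simp only [Pi.add_apply, Pi.sub_apply]
      omega
    rw [this, prodPow_add, Submodule.mul_smul]
    refine Submodule.smul_mono le_rfl ?_
    refine le_inf (Submodule.smul_le.2 fun a _ z hz => D.smul_mem a hz.1) ?_
    refine (Submodule.smul_mono le_rfl inf_le_right).trans ?_
    rw [← Submodule.mul_smul, ← prodPow_add, tsub_add_cancel_of_le e.2.1]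
  rintro z ⟨hzD, hzN⟩
  have hz : ∃ p : Fin g → MvPolynomial σ R, (∀ j, (p j).IsWeightedHomogeneous w n) ∧
      ∑ j, MvPolynomial.eval x (p j) • y j = z := by
    have hzN' : z ∈ prodPow I n • N := hzN
    clear hzD hzN
    induction hzN' using Submodule.smul_induction_on' with
    | smul a ha m hm =>
      rw [← hy] at hm
      obtain ⟨b, rfl⟩ := (Submodule.mem_span_range_iff_exists_fun R).1 hm
      obtain ⟨q, hq, rfl⟩ := (mem_homogVal w x n a).1 (prodPow_le_homogVal w x I hI n ha)
      refine ⟨fun j => MvPolynomial.C (b j) * q, fun j => hq.C_mul _, ?_⟩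
      simp [Finset.smul_sum, smul_smul, mul_comm]
    | add z1 _ z2 _ h1 h2 =>
      obtain ⟨p, hp, rfl⟩ := h1
      obtain ⟨q, hq, rfl⟩ := h2
      exact ⟨p + q, fun j => (hp j).add (hq j), by simp [add_smul, Finset.sum_add_distrib]⟩
  obtain ⟨p, hp, rfl⟩ := hz
  have hpn : ∀ m, θ m p = if m = n then ∑ j, MvPolynomial.eval x (p j) • y j else 0 := by
    intro m
    simp only [θ, thetaMap_apply]
    split_ifs with h
    · refine Finset.sum_congr rfl fun j _ => ?_
      rw [MvPolynomial.weightedHomogeneousComponent_of_mem (hp j), if_pos h]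
    · refine Finset.sum_eq_zero fun j _ => ?_
      rw [MvPolynomial.weightedHomogeneousComponent_of_mem (hp j), if_neg h, map_zero, zero_smul]
  have hpD : p ∈ 𝓓 := by
    intro m
    rw [hpn]
    split_ifs
    · exact hzD
    · exact D.zero_mem
  have := hA p (hG ▸ hpD) n
  rw [hpn, if_pos rfl] at this
  exact hAn this

end ArtinRees

section ARFamilies

open Filter

variable {R : Type u} [CommRing R] {r : ℕ} (I : Fin r → Ideal R)

/-- A family of submodules of the form `W + I^{n-c} W'` for `n ≥ c`. -/
def ARFam {T : Type u} [AddCommGroup T] [Module R T] (U : (Fin r → ℕ) → Submodule R T) : Prop :=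
  ∃ (c : Fin r → ℕ) (W W' : Submodule R T), ∀ n, c ≤ n → U n = W ⊔ prodPow I (n - c) • W'

section

variable {I} {T T' : Type u} [AddCommGroup T] [Module R T] [AddCommGroup T'] [Module R T']

lemma ARFam.ge {U : (Fin r → ℕ) → Submodule R T} (h : ARFam I U) :
    ∃ c : Fin r → ℕ, ∀ c', c ≤ c' → ∃ W W' : Submodule R T,
      ∀ n, c' ≤ n → U n = W ⊔ prodPow I (n - c') • W' := by
  obtain ⟨c, W, W', hU⟩ := h
  refine ⟨c, fun c' hc => ⟨W, prodPow I (c' - c) • W', fun n hn => ?_⟩⟩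
  rw [hU n (hc.trans hn), ← Submodule.mul_smul, ← prodPow_add, tsub_add_tsub_cancel hn hc]

lemma ARFam.const (W : Submodule R T) : ARFam I (fun _ => W) :=
  ⟨0, W, ⊥, fun n _ => by simp⟩

lemma ARFam.pow (N : Submodule R T) : ARFam I (fun n => prodPow I n • N) :=
  ⟨0, ⊥, N, fun n _ => by simp⟩

lemma ARFam.sup {U V : (Fin r → ℕ) → Submodule R T} (hU : ARFam I U) (hV : ARFam I V) :
    ARFam I (fun n => U n ⊔ V n) := by
  obtain ⟨c, hc⟩ := hU.ge
  obtain ⟨d, hd⟩ := hV.ge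
  obtain ⟨W, W', h⟩ := hc (c ⊔ d) le_sup_left
  obtain ⟨Z, Z', h'⟩ := hd (c ⊔ d) le_sup_right
  refine ⟨c ⊔ d, W ⊔ Z, W' ⊔ Z', fun n hn => ?_⟩
  simp only
  rw [h n hn, h' n hn, Submodule.smul_sup]
  exact sup_sup_sup_comm _ _ _ _

lemma ARFam.map {U : (Fin r → ℕ) → Submodule R T} (hU : ARFam I U) (φ : T →ₗ[R] T') :
    ARFam I (fun n => (U n).map φ) := by
  obtain ⟨c, W, W', h⟩ := hU
  refine ⟨c, W.map φ, W'.map φ, fun n hn => ?_⟩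
  simp only
  rw [h n hn, Submodule.map_sup, Submodule.map_smul'']

lemma ARFam.comap [IsNoetherianRing R] [Module.Finite R T']
    {U : (Fin r → ℕ) → Submodule R T'} (hU : ARFam I U) (φ : T →ₗ[R] T') :
    ARFam I (fun n => (U n).comap φ) := by
  obtain ⟨c, W, W', h⟩ := hU
  let ψ : T →ₗ[R] T' ⧸ W := W.mkQ ∘ₗ φ
  obtain ⟨N, hN⟩ : ∃ N, N = W'.map W.mkQ := ⟨_, rfl⟩
  obtain ⟨d, hd⟩ := multiAR I (LinearMap.range ψ) N
  refine ⟨c + d, LinearMap.ker ψ, (prodPow I d • N).comap ψ, fun n hn => ?_⟩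
  have hcn : c ≤ n := le_trans le_self_add hn
  have hdn : d ≤ n - c := by
    intro i
    have : c i + d i ≤ n i := hn i
    simp only [Pi.sub_apply]
    omega
  have e1 : (U n).comap φ = (prodPow I (n - c) • N).comap ψ := by
    rw [h n hcn]
    simp only [ψ, hN, Submodule.comap_comp, ← Submodule.map_smul'', Submodule.comap_map_mkQ]
  have e2 : n - (c + d) = n - c - d := (tsub_tsub _ _ _).symm
  have e3 : (LinearMap.range ψ ⊓ prodPow I d • N) = ((prodPow I d • N).comap ψ).map ψ := by
    rw [Submodule.map_comap_eq]
  have e4 := hd (n - c) hdn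
  rw [e3, ← Submodule.map_smul''] at e4
  simp only
  rw [e1, e2]
  apply le_antisymm
  · intro t ht
    have := e4 ⟨⟨t, rfl⟩, ht⟩
    have : t ∈ Submodule.comap ψ (Submodule.map ψ
      (prodPow I (n - c - d) • Submodule.comap ψ (prodPow I d • N))) := this
    rwa [Submodule.comap_map_eq, sup_comm] at this
  · refine sup_le (fun t ht => ?_) ?_
    · have : ψ t = 0 := ht
      simp [Submodule.mem_comap, this]
    · rw [← Submodule.map_le_iff_le_comap, Submodule.map_smul'']
      refine (Submodule.smul_mono le_rfl (Submodule.map_comap_le _ _)).trans ?_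
      rw [← Submodule.mul_smul, ← prodPow_add, tsub_add_cancel_of_le hdn]

lemma ARFam.iSup {ι : Type*} (s : Finset ι) {U : ι → (Fin r → ℕ) → Submodule R T}
    (hU : ∀ i, ARFam I (U i)) : ARFam I (fun n => ⨆ i ∈ s, U i n) := by
  classical
  induction s using Finset.induction_on with
  | empty => simpa using ARFam.const ⊥
  | insert i s hi ih =>
    simp only [Finset.iSup_insert]
    exact (hU i).sup ih

lemma ARFam.pi {a : ℕ} {U : (Fin r → ℕ) → Submodule R T} (hU : ARFam I U) :
    ARFam I (fun n => Submodule.pi Set.univ (fun _ : Fin a => U n)) := by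
  classical
  have := ARFam.iSup (I := I) (Finset.univ : Finset (Fin a))
    (U := fun i n => (U n).map (LinearMap.single R (fun _ => T) i)) fun i => hU.map _
  convert this using 2 with n
  simp [Submodule.iSup_map_single]

lemma ARFam.inf [IsNoetherianRing R] [Module.Finite R T]
    {U V : (Fin r → ℕ) → Submodule R T} (hU : ARFam I U) (hV : ARFam I V) :
    ARFam I (fun n => U n ⊓ V n) := by
  have h1 : ARFam I (fun n => (U n).prod (V n)) := by
    have := (hU.map (LinearMap.inl R T T)).sup (hV.map (LinearMap.inr R T T))
    convert this using 2 with n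
    simp [Submodule.map_inl, Submodule.map_inr]
  have := h1.comap (LinearMap.prod LinearMap.id LinearMap.id)
  convert this using 2 with n
  ext t
  simp [Submodule.mem_prod]

lemma ARFam.le_eventually {U V : (Fin r → ℕ) → Submodule R T} (hU : ARFam I U)
    (hV : ARFam I V) : (∀ᶠ n in atTop, U n ≤ V n) ∨ (∀ᶠ n in atTop, ¬ U n ≤ V n) := by
  obtain ⟨c, hc⟩ := hU.ge
  obtain ⟨d, hd⟩ := hV.ge
  obtain ⟨A, A', h⟩ := hc (c ⊔ d) le_sup_left
  obtain ⟨B, B', h'⟩ := hd (c ⊔ d) le_sup_right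
  set e := c ⊔ d
  by_cases hP : ∃ n, e ≤ n ∧ ¬ A ≤ B ⊔ prodPow I (n - e) • B'
  · right
    obtain ⟨m, hm, hm'⟩ := hP
    filter_upwards [eventually_ge_atTop m] with n hn hle
    rw [h n (hm.trans hn), h' n (hm.trans hn)] at hle
    refine hm' ((le_sup_left.trans hle).trans (sup_le_sup_left ?_ _))
    exact Submodule.smul_mono (prodPow_le I (tsub_le_tsub_right hn e)) le_rfl
  push Not at hP
  by_cases hQ : ∃ n, e ≤ n ∧ prodPow I (n - e) • A' ≤ B ⊔ prodPow I (n - e) • B'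
  · left
    obtain ⟨m, hm, hm'⟩ := hQ
    filter_upwards [eventually_ge_atTop m] with n hn
    rw [h n (hm.trans hn), h' n (hm.trans hn)]
    refine sup_le (hP n (hm.trans hn)) ?_
    have : n - e = (n - m) + (m - e) := (tsub_add_tsub_cancel hn hm).symm
    rw [this, prodPow_add, Submodule.mul_smul, Submodule.mul_smul]
    refine (Submodule.smul_mono le_rfl hm').trans ?_
    rw [Submodule.smul_sup]
    exact sup_le_sup_right Submodule.smul_le_right _
  · right
    push Not at hQ
    filter_upwards [eventually_ge_atTop e] with n hn hle
    rw [h n hn, h' n hn] at hle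
    exact hQ n hn (le_sup_right.trans hle)

end

/-- A family of modules which are subquotients `U n / V n` for families as above. -/
def ARMod (X : (Fin r → ℕ) → Type u) [∀ n, AddCommGroup (X n)] [∀ n, Module R (X n)] : Prop :=
  ∃ (T : Type u) (_ : AddCommGroup T) (_ : Module R T) (_ : Module.Finite R T)
    (U V : (Fin r → ℕ) → Submodule R T), ARFam I U ∧ ARFam I V ∧
    ∀ n, ∃ π : U n →ₗ[R] X n, Function.Surjective π ∧ ∀ u, π u = 0 ↔ (u : T) ∈ V n

lemma ARMod.quot (M : Type u) [AddCommGroup M] [Module R M] [Module.Finite R M]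
    (N : Submodule R M) : ARMod I (fun n => M ⧸ (prodPow I n • N : Submodule R M)) := by
  refine ⟨M, inferInstance, inferInstance, inferInstance, fun _ => ⊤, fun n => prodPow I n • N,
    ARFam.const _, ARFam.pow _, fun n => ⟨Submodule.mkQ _ ∘ₗ Submodule.subtype _, ?_, ?_⟩⟩
  · intro y
    obtain ⟨x, rfl⟩ := Submodule.mkQ_surjective _ y
    exact ⟨⟨x, trivial⟩, rfl⟩
  · intro u
    simp

variable {I} in
lemma ARMod.subsingleton_eventually {X : (Fin r → ℕ) → Type u} [∀ n, AddCommGroup (X n)]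
    [∀ n, Module R (X n)] (h : ARMod I X) :
    (∀ᶠ n in atTop, Subsingleton (X n)) ∨ (∀ᶠ n in atTop, ¬ Subsingleton (X n)) := by
  obtain ⟨T, _, _, _, U, V, hU, hV, hX⟩ := h
  have : ∀ n, Subsingleton (X n) ↔ U n ≤ V n := by
    intro n
    obtain ⟨π, hπ, hk⟩ := hX n
    constructor
    · intro h u hu
      exact (hk ⟨u, hu⟩).1 (Subsingleton.elim _ _)
    · intro h
      refine subsingleton_of_forall_eq 0 fun y => ?_
      obtain ⟨u, rfl⟩ := hπ y
      exact (hk u).2 (h u.2)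
  simp only [this]
  exact hU.le_eventually hV

/-- Action of a matrix on tuples of elements of a module. -/
noncomputable def matMap {a b : ℕ} (B : Fin b → Fin a → R) (T : Type u) [AddCommGroup T]
    [Module R T] : (Fin a → T) →ₗ[R] (Fin b → T) :=
  LinearMap.pi fun j => ∑ i, B j i • LinearMap.proj i

@[simp] lemma matMap_apply {a b : ℕ} (B : Fin b → Fin a → R) (T : Type u) [AddCommGroup T]
    [Module R T] (v : Fin a → T) (j : Fin b) : matMap B T v j = ∑ i, B j i • v i := by
  simp [matMap]

lemma exists_presentation (K : Type u) [AddCommGroup K] [Module R K] [Module.Finite R K]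
    [IsNoetherianRing R] : ∃ (a b : ℕ) (k : Fin a → K) (ρ : Fin b → Fin a → R),
      Submodule.span R (Set.range k) = ⊤ ∧
      ∀ (X : Type u) [AddCommGroup X] [Module R X] (v : Fin a → X),
        (matMap ρ X v = 0 ↔ ∃ h : K →ₗ[R] X, ∀ i, h (k i) = v i) := by
  obtain ⟨a, k, hk⟩ := Submodule.fg_iff_exists_fin_generating_family.1 (Module.Finite.fg_top (R := R) (M := K))
  let p : (Fin a → R) →ₗ[R] K := Fintype.linearCombination R k
  have hp : Function.Surjective p := by
    rw [← LinearMap.range_eq_top, Fintype.range_linearCombination, hk]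
  obtain ⟨b, ρ, hρ⟩ := Submodule.fg_iff_exists_fin_generating_family.1
    (IsNoetherian.noetherian (LinearMap.ker p))
  refine ⟨a, b, k, ρ, hk, fun X _ _ v => ⟨fun hv => ?_, ?_⟩⟩
  · let φ : (Fin a → R) →ₗ[R] X := Fintype.linearCombination R v
    have hle : LinearMap.ker p ≤ LinearMap.ker φ := by
      rw [← hρ, Submodule.span_le]
      rintro _ ⟨j, rfl⟩
      have := congrFun hv j
      simpa [φ, Fintype.linearCombination_apply] using this
    refine ⟨(LinearMap.ker p).liftQ φ hle ∘ₗ (p.quotKerEquivOfSurjective hp).symm.toLinearMap,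
      fun i => ?_⟩
    classical
    have h1 : k i = p (Pi.single i 1) := by simp [p]
    have h2 : (p.quotKerEquivOfSurjective hp).symm (k i) =
        (LinearMap.ker p).mkQ (Pi.single i 1) := by
      rw [LinearEquiv.symm_apply_eq, h1]
      rfl
    simp [h2, φ]
  · rintro ⟨h, hh⟩
    funext j
    have h1 : p (ρ j) = 0 := by
      have : ρ j ∈ LinearMap.ker p := hρ ▸ Submodule.subset_span ⟨j, rfl⟩
      exact this
    have := congrArg h h1
    simpa [p, Fintype.linearCombination_apply, hh] using this

variable {I} in
lemma ARMod.coherent [IsNoetherianRing R] {X : (Fin r → ℕ) → Type u} [∀ n, AddCommGroup (X n)]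
    [∀ n, Module R (X n)] (h : ARMod I X) {K L : Type u} [AddCommGroup K] [Module R K]
    [Module.Finite R K] [AddCommGroup L] [Module R L] [Module.Finite R L] (f : K →ₗ[R] L) :
    ARMod I (fun n => coherentApply f (X n)) := by
  obtain ⟨T, _, _, _, U, V, hU, hV, hX⟩ := h
  obtain ⟨a, b, k, ρ, hk, hρ⟩ := exists_presentation (R := R) K
  obtain ⟨l, e, ℓ, τ, hℓ, hτ⟩ := exists_presentation (R := R) L
  have hB : ∀ i, ∃ c : Fin l → R, ∑ j, c j • ℓ j = f (k i) := fun i =>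
    (Submodule.mem_span_range_iff_exists_fun R).1 (hℓ ▸ Submodule.mem_top)
  choose B hB using hB
  have hpU : ∀ d : ℕ, ARFam I (fun n => Submodule.pi Set.univ (fun _ : Fin d => U n)) :=
    fun d => hU.pi
  have hpV : ∀ d : ℕ, ARFam I (fun n => Submodule.pi Set.univ (fun _ : Fin d => V n)) :=
    fun d => hV.pi
  refine ⟨Fin a → T, inferInstance, inferInstance, inferInstance, _, _,
    (hpU a).inf ((hpV b).comap (matMap ρ T)),
    (((hpU l).inf ((hpV e).comap (matMap τ T))).map (matMap B T)).sup (hpV a), fun n => ?_⟩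
  obtain ⟨π, hπ, hker⟩ := hX n
  -- linear combinations
  have hlin : ∀ {d : ℕ} (c : Fin d → R) (m : Fin d → T) (hm : ∀ i, m i ∈ U n),
      ∃ hu : ∑ i, c i • m i ∈ U n, π ⟨∑ i, c i • m i, hu⟩ = ∑ i, c i • π ⟨m i, hm i⟩ := by
    intro d c m hm
    refine ⟨Submodule.sum_mem _ fun i _ => Submodule.smul_mem _ _ (hm i), ?_⟩
    simp only [← map_smul, ← map_sum]
    congr 1
    ext
    simp
  have hrel : ∀ {d d' : ℕ} (c : Fin d' → Fin d → R) (m : Fin d → T) (hm : ∀ i, m i ∈ U n),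
      matMap c T m ∈ Submodule.pi Set.univ (fun _ : Fin d' => V n) ↔
      matMap c (X n) (fun i => π ⟨m i, hm i⟩) = 0 := by
    intro d d' c m hm
    rw [funext_iff]
    simp only [Submodule.mem_pi, Set.mem_univ, true_imp_iff, matMap_apply, Pi.zero_apply]
    refine forall_congr' fun j => ?_
    obtain ⟨hu, hu'⟩ := hlin (c j) m hm
    rw [← hu', hker]
  let ev : (K →ₗ[R] X n) →ₗ[R] (Fin a → X n) := LinearMap.pi fun i => LinearMap.applyₗ (k i)
  have hev : Function.Injective ev := by
    intro g g' hg
    refine LinearMap.ext_on_range hk fun i => ?_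
    exact congrFun hg i
  let U'' : Submodule R (Fin a → T) := Submodule.pi Set.univ (fun _ : Fin a => U n) ⊓
    (Submodule.pi Set.univ (fun _ : Fin b => V n)).comap (matMap ρ T)
  have hU'' : ∀ m : U'', ∀ i, m.1 i ∈ U n := fun m i => m.2.1 i trivial
  let Pm : U'' →ₗ[R] (Fin a → X n) := LinearMap.pi fun i => π ∘ₗ
    ((LinearMap.proj i ∘ₗ U''.subtype).codRestrict (U n) fun m => hU'' m i)
  have hPm : ∀ m i, Pm m i = π ⟨m.1 i, hU'' m i⟩ := fun m i => rfl
  have hPmr : ∀ m, Pm m ∈ LinearMap.range ev := by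
    intro m
    have h1 := (hrel ρ m.1 (hU'' m)).1 m.2.2
    obtain ⟨g, hg⟩ := (hρ (X n) _).1 h1
    exact ⟨g, funext hg⟩
  let Φ : U'' →ₗ[R] (K →ₗ[R] X n) := (LinearEquiv.ofInjective ev hev).symm.toLinearMap ∘ₗ
    Pm.codRestrict _ hPmr
  have hΦ : ∀ m i, Φ m (k i) = π ⟨m.1 i, hU'' m i⟩ := by
    intro m i
    have h1 : (LinearEquiv.ofInjective ev hev) (Φ m) = Pm.codRestrict _ hPmr m := by
      simp [Φ]
    have h2 : ev (Φ m) = Pm m := congrArg Subtype.val h1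
    exact congrFun h2 i
  refine ⟨Submodule.mkQ _ ∘ₗ Φ, ?_, ?_⟩
  · rw [LinearMap.coe_comp]
    refine (Submodule.mkQ_surjective _).comp fun g => ?_
    choose m hm using fun i => hπ (g (k i))
    have hmU : (fun i => (m i : T)) ∈ U'' := by
      refine ⟨fun i _ => (m i).2, ?_⟩
      refine (hrel ρ (fun i => (m i : T)) (fun i => (m i).2)).2 ?_
      exact (hρ (X n) _).2 ⟨g, fun i => (hm i).symm⟩
    refine ⟨⟨_, hmU⟩, ?_⟩
    refine LinearMap.ext_on_range hk fun i => ?_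
    rw [hΦ]
    exact hm i
  · intro m
    rw [LinearMap.comp_apply, Submodule.mkQ_apply, Submodule.Quotient.mk_eq_zero]
    constructor
    · rintro ⟨g, hg⟩
      choose m' hm' using fun j => hπ (g (ℓ j))
      refine Submodule.mem_sup.2 ⟨matMap B T (fun j => (m' j : T)), ⟨_, ⟨fun j _ => (m' j).2, ?_⟩,
        rfl⟩, m.1 - matMap B T (fun j => (m' j : T)), ?_, by abel⟩
      · refine (hrel τ (fun i => (m' i : T)) (fun i => (m' i).2)).2 ?_
        exact (hτ (X n) _).2 ⟨g, fun i => (hm' i).symm⟩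
      · intro i _
        obtain ⟨hu, hu'⟩ := hlin (B i) (fun j => (m' j : T)) (fun j => (m' j).2)
        have h1 : m.1 i - ∑ j, B i j • (m' j : T) ∈ U n := Submodule.sub_mem _ (hU'' m i) hu
        have h2 := (hker ⟨_, h1⟩).1 ?_
        · simpa using h2
        · have h3 : (⟨_, h1⟩ : U n) = ⟨m.1 i, hU'' m i⟩ - ⟨_, hu⟩ := rfl
          rw [h3, map_sub, hu', ← hΦ, ← hg]
          simp only [Subtype.coe_eta, hm', LinearMap.lcomp_apply, ← hB, map_sum, map_smul, sub_self]
    · intro hm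
      obtain ⟨z, ⟨m', ⟨hm'U, hm'V⟩, rfl⟩, y, hy, hsum⟩ := Submodule.mem_sup.1 hm
      have hm'U' : ∀ j, m' j ∈ U n := fun j => hm'U j trivial
      have h1 := (hrel τ m' hm'U').1 hm'V
      obtain ⟨g, hg⟩ := (hτ (X n) _).1 h1
      refine ⟨g, LinearMap.ext_on_range hk fun i => ?_⟩
      rw [hΦ, LinearMap.lcomp_apply, ← hB, map_sum]
      simp only [map_smul, hg]
      obtain ⟨hu, hu'⟩ := hlin (B i) m' hm'U'
      rw [← hu', eq_comm, ← sub_eq_zero, ← map_sub, hker]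
      have h4 : m.1 i - ∑ j, B i j • m' j = y i := by
        rw [← hsum]; simp
      have h5 : m.1 i - ∑ j, B i j • m' j ∈ V n := by
        rw [h4]; exact hy i trivial
      exact h5

end ARFamilies

section Bridge

variable {R : Type u} [CommRing R]

lemma subsingleton_oldExt_iff (Y X : ModuleCat.{u} R) (m : ℕ) :
    Subsingleton ↥(((Ext R (ModuleCat.{u} R) (m + 1)).obj (Opposite.op Y)).obj X) ↔
      Subsingleton (Abelian.Ext Y X (m + 1)) := by
  obtain ⟨P⟩ := HasProjectiveResolution.out (Z := Y)
  have h1 : Subsingleton ↥(((Ext R (ModuleCat.{u} R) (m + 1)).obj (Opposite.op Y)).obj X) ↔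
      ∀ φ : P.complex.X (m + 1) ⟶ X, P.complex.d (m + 2) (m + 1) ≫ φ = 0 →
        ∃ ψ : P.complex.X m ⟶ X, P.complex.d (m + 1) m ≫ ψ = φ := by
    rw [← ModuleCat.isZero_iff_subsingleton, (P.isoExt (R := R) (m + 1) X).isZero_iff,
      ← HomologicalComplex.exactAt_iff_isZero_homology,
      HomologicalComplex.exactAt_iff' _ m (m + 1) (m + 2) (by simp) (by simp),
      ShortComplex.moduleCat_exact_iff]
    rfl
  have h2 : Subsingleton (Abelian.Ext Y X (m + 1)) ↔
      ∀ φ : P.complex.X (m + 1) ⟶ X, P.complex.d (m + 2) (m + 1) ≫ φ = 0 →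
        ∃ ψ : P.complex.X m ⟶ X, P.complex.d (m + 1) m ≫ ψ = φ := by
    constructor
    · intro h φ hφ
      exact (P.extMk_eq_zero_iff φ (m + 2) rfl hφ m rfl).1 (Subsingleton.elim _ _)
    · intro h
      refine subsingleton_of_forall_eq 0 fun e => ?_
      obtain ⟨φ, hφ, rfl⟩ := P.extMk_surjective e (m + 2) rfl
      exact (P.extMk_eq_zero_iff φ (m + 2) rfl hφ m rfl).2 (h φ hφ)
  rw [h1, h2]

lemma bridge (X : Type u) [AddCommGroup X] [Module R X] (m : ℕ) :
    (∀ Y : ModuleCat.{u} R, Subsingleton ↥(((Ext R (ModuleCat.{u} R) (m + 1)).obj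
      (Opposite.op Y)).obj (ModuleCat.of R X))) ↔
      HasInjectiveDimensionLT (ModuleCat.of R X) (m + 1) := by
  simp only [subsingleton_oldExt_iff]
  exact ⟨fun h => hasInjectiveDimensionLT_of_enoughProjectives _ _ h,
    fun h Y => h.subsingleton _ _ _ le_rfl Y⟩

lemma injDim_eq_of_iff {X X' : Type u} [AddCommGroup X] [Module R X] [AddCommGroup X']
    [Module R X'] (h : ∀ m, HasInjectiveDimensionLT (ModuleCat.of R X) (m + 1) ↔
      HasInjectiveDimensionLT (ModuleCat.of R X') (m + 1)) : injDim R X = injDim R X' := by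
  simp only [injDim, bridge, h]

end Bridge

section ExtVanish

open Abelian

variable {R : Type u} [CommRing R]

variable (R) in
/-- Vanishing of `Ext^t(Y, X)`. -/
def EV (Y X : Type u) [AddCommGroup Y] [Module R Y] [AddCommGroup X] [Module R X] (t : ℕ) : Prop :=
  ∀ e : Abelian.Ext (ModuleCat.of R Y) (ModuleCat.of R X) t, e = 0

variable {A B C X : Type u} [AddCommGroup A] [Module R A] [AddCommGroup B] [Module R B]
  [AddCommGroup C] [Module R C] [AddCommGroup X] [Module R X]

/-- The short complex attached to an exact pair. -/
noncomputable abbrev sc (f : A →ₗ[R] B) (g : B →ₗ[R] C) (h : Function.Exact f g) :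
    ShortComplex (ModuleCat.{u} R) :=
  ModuleCat.shortComplexOfCompEqZero f g h.linearMap_comp_eq_zero

lemma sc_exact (f : A →ₗ[R] B) (g : B →ₗ[R] C) (h : Function.Exact f g)
    (hf : Function.Injective f) (hg : Function.Surjective g) : (sc f g h).ShortExact :=
  ModuleCat.shortComplex_shortExact _ h hf hg

lemma EV.mid {f : A →ₗ[R] B} {g : B →ₗ[R] C} (h : Function.Exact f g)
    (hf : Function.Injective f) (hg : Function.Surjective g) {t : ℕ}
    (h1 : EV R A X t) (h3 : EV R C X t) : EV R B X t := by
  intro e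
  obtain ⟨x, rfl⟩ := Ext.contravariant_sequence_exact₂ (sc_exact f g h hf hg) _ e (h1 _)
  rw [h3 x, Ext.comp_zero]

lemma EV.left {f : A →ₗ[R] B} {g : B →ₗ[R] C} (h : Function.Exact f g)
    (hf : Function.Injective f) (hg : Function.Surjective g) {t : ℕ}
    (h2 : EV R B X t) (h3 : EV R C X (t + 1)) : EV R A X t := by
  intro e
  obtain ⟨x, rfl⟩ := Ext.contravariant_sequence_exact₁ (sc_exact f g h hf hg) _ e
    (add_comm 1 t) (h3 _)
  rw [h2 x, Ext.comp_zero]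

lemma EV.right {f : A →ₗ[R] B} {g : B →ₗ[R] C} (h : Function.Exact f g)
    (hf : Function.Injective f) (hg : Function.Surjective g) {t : ℕ}
    (h1 : EV R A X t) (h2 : EV R B X (t + 1)) : EV R C X (t + 1) := by
  intro e
  obtain ⟨x, rfl⟩ := Ext.contravariant_sequence_exact₃ (sc_exact f g h hf hg) _ e
    (h2 _) (add_comm 1 t)
  rw [h1 x, Ext.comp_zero]

lemma EV.of_subsingleton [Subsingleton A] (t : ℕ) : EV R A X t := by
  intro e
  have h : (𝟙 (ModuleCat.of R A)) = 0 := by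
    ext x
    exact Subsingleton.elim (α := A) _ _
  rw [← Ext.mk₀_id_comp e, h, Ext.mk₀_zero, Ext.zero_comp]

lemma EV.congr (e : A ≃ₗ[R] B) {t : ℕ} (h : EV R A X t) : EV R B X t := by
  refine EV.mid (A := A) (C := PUnit) (f := e.toLinearMap) (g := 0) ?_ e.injective ?_ h
    (EV.of_subsingleton t)
  · intro x
    simp
  · intro x
    exact ⟨0, Subsingleton.elim _ _⟩

lemma EV.of_projective [Module.Projective R A] (t : ℕ) : EV R A X (t + 1) := fun e => by
  have : Projective (ModuleCat.of R A) := (IsProjective.iff_projective A).1 inferInstance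
  exact Ext.eq_zero_of_projective e

lemma EV.extend {f : A →ₗ[R] B} {g : B →ₗ[R] C} (h : Function.Exact f g)
    (hf : Function.Injective f) (hg : Function.Surjective g) (h3 : EV R C X 1) (φ : A →ₗ[R] X) :
    ∃ ψ : B →ₗ[R] X, ψ ∘ₗ f = φ := by
  obtain ⟨x, hx⟩ := Ext.contravariant_sequence_exact₁ (sc_exact f g h hf hg) (ModuleCat.of R X)
    (Ext.mk₀ (ModuleCat.ofHom φ)) (add_comm 1 0) (h3 _)
  obtain ⟨y, rfl⟩ := Ext.homEquiv₀.symm.surjective x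
  refine ⟨y.hom, ?_⟩
  rw [Ext.homEquiv₀_symm_apply, Ext.mk₀_comp_mk₀] at hx
  have := (Ext.homEquiv₀.symm.injective hx : _ = _)
  exact congrArg ModuleCat.Hom.hom this

lemma EV.of_extend {f : A →ₗ[R] B} {g : B →ₗ[R] C} (h : Function.Exact f g)
    (hf : Function.Injective f) (hg : Function.Surjective g) [Module.Projective R B]
    (H : ∀ φ : A →ₗ[R] X, ∃ ψ : B →ₗ[R] X, ψ ∘ₗ f = φ) : EV R C X 1 := by
  intro e
  obtain ⟨x, rfl⟩ := Ext.contravariant_sequence_exact₃ (sc_exact f g h hf hg) _ e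
    (EV.of_projective 0 _) (add_comm 1 0)
  obtain ⟨y, rfl⟩ := Ext.homEquiv₀.symm.surjective x
  obtain ⟨ψ, hψ⟩ := H y.hom
  have h2 : Ext.mk₀ y = (Ext.mk₀ (sc f g h).f).comp
      (Ext.mk₀ (ModuleCat.ofHom ψ)) (zero_add 0) := by
    rw [Ext.mk₀_comp_mk₀]
    congr 1
    ext1
    exact hψ.symm
  rw [Ext.homEquiv₀_symm_apply, h2, ← Ext.comp_assoc (a₁₂ := 1) _ _ _ _ _ (by omega),
    (sc_exact f g h hf hg).extClass_comp, Ext.zero_comp]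
  rfl

lemma ev_iff_coherent [IsNoetherianRing R] (t : ℕ) (Y : Type u) [AddCommGroup Y] [Module R Y]
    [Module.Finite R Y] : ∃ (K L : Type u) (_ : AddCommGroup K) (_ : Module R K)
      (_ : Module.Finite R K) (_ : AddCommGroup L) (_ : Module R L) (_ : Module.Finite R L)
      (f : K →ₗ[R] L), ∀ (X : Type u) [AddCommGroup X] [Module R X],
      EV R Y X (t + 1) ↔ Subsingleton (coherentApply f X) := by
  induction t generalizing Y with
  | zero =>
    obtain ⟨P, _, _, _, _, g, hg⟩ := Module.exists_finite_presentation R Y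
    refine ⟨LinearMap.ker g, P, inferInstance, inferInstance, inferInstance, inferInstance,
      inferInstance, inferInstance, (LinearMap.ker g).subtype, fun X _ _ => ?_⟩
    rw [Submodule.Quotient.subsingleton_iff, LinearMap.range_eq_top]
    have hex := LinearMap.exact_subtype_ker_map g
    constructor
    · intro h φ
      exact EV.extend hex (Submodule.injective_subtype _) hg h φ
    · intro h
      exact EV.of_extend hex (Submodule.injective_subtype _) hg h
  | succ t ih =>
    obtain ⟨P, _, _, _, _, g, hg⟩ := Module.exists_finite_presentation R Y
    obtain ⟨K, L, _, _, _, _, _, _, f, hf⟩ := ih (LinearMap.ker g)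
    refine ⟨K, L, _, _, inferInstance, _, _, inferInstance, f, fun X _ _ => ?_⟩
    rw [← hf]
    have hex := LinearMap.exact_subtype_ker_map g
    exact ⟨fun h => EV.left hex (Submodule.injective_subtype _) hg (EV.of_projective _) h,
      fun h => EV.right hex (Submodule.injective_subtype _) hg h (EV.of_projective _)⟩

end ExtVanish

section InjBound

open Abelian

variable {R : Type u} [CommRing R]

lemma injLT_of_cyclic (s : ℕ) (X : ModuleCat.{u} R)
    (h : ∀ (J : Ideal R) (e : Abelian.Ext (ModuleCat.of R (R ⧸ J)) X (s + 1)), e = 0) :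
    HasInjectiveDimensionLT X (s + 1) := by
  induction s generalizing X with
  | zero =>
    rw [zero_add, ← injective_iff_hasInjectiveDimensionLT_one]
    refine (Module.injective_iff_injective_object R X).1 (Module.Baer.iff_injective.1 ?_)
    rw [Module.Baer.iff_surjective]
    intro J φ
    refine EV.extend (C := R ⧸ J) (g := J.mkQ) ?_ (Submodule.injective_subtype _)
      (Submodule.mkQ_surjective _) (fun e => h J e) φ
    exact LinearMap.exact_subtype_mkQ J
  | succ s ih =>
    obtain ⟨ip⟩ := EnoughInjectives.presentation X
    have hS := ip.shortExact_shortComplex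
    have hI : Injective ip.shortComplex.X₂ := ip.injective
    refine (hS.hasInjectiveDimensionLT_X₃_iff s hI).1 (ih _ fun J e => ?_)
    obtain ⟨x, rfl⟩ := Ext.covariant_sequence_exact₃ _ hS e rfl (h J _)
    rw [Ext.eq_zero_of_hasInjectiveDimensionLT x 1 (by omega), Ext.zero_comp]

lemma EV.of_injLT {Y X : Type u} [AddCommGroup Y] [Module R Y] [AddCommGroup X] [Module R X]
    {s t : ℕ} (h : HasInjectiveDimensionLT (ModuleCat.of R X) s) (hst : s ≤ t) : EV R Y X t :=
  fun e => Ext.eq_zero_of_hasInjectiveDimensionLT e s hst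

lemma EV.nakayama [IsNoetherianRing R] [IsLocalRing R] {A C X : Type u} [AddCommGroup A]
    [Module R A] [AddCommGroup C] [Module R C] [AddCommGroup X] [Module R X] [Module.Finite R A]
    [Module.Finite R X] {x : R} (hx : x ∈ IsLocalRing.maximalIdeal R) {g : A →ₗ[R] C}
    (h : Function.Exact (x • (LinearMap.id : A →ₗ[R] A)) g)
    (hf : Function.Injective (x • (LinearMap.id : A →ₗ[R] A))) (hg : Function.Surjective g)
    {t : ℕ} (h3 : EV R C X (t + 1)) : EV R A X t := by
  have hfin : Module.Finite R (Abelian.Ext (ModuleCat.of R A) (ModuleCat.of R X) t) :=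
    ModuleCat.finite_ext R _ _ _
  have key : (⊤ : Submodule R (Abelian.Ext (ModuleCat.of R A) (ModuleCat.of R X) t)) ≤
      IsLocalRing.maximalIdeal R • ⊤ := by
    intro e _
    obtain ⟨y, hy⟩ := Ext.contravariant_sequence_exact₁ (sc_exact _ g h hf hg) _ e
      (add_comm 1 t) (h3 _)
    have h1 : (sc _ g h).f = x • 𝟙 (ModuleCat.of R A) := rfl
    rw [h1, Ext.mk₀_smul, Ext.smul_comp, Ext.mk₀_id_comp] at hy
    rw [← hy]
    exact Submodule.smul_mem_smul hx trivial
  have := Submodule.eq_bot_of_le_smul_of_le_jacobson_bot _ _ hfin.fg_top key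
    (IsLocalRing.maximalIdeal_le_jacobson _)
  intro e
  have : e ∈ (⊤ : Submodule R (Abelian.Ext (ModuleCat.of R A) (ModuleCat.of R X) t)) := trivial
  simpa [‹⊤ = ⊥›] using this

lemma mulSeq (J : Ideal R) (x : R) (hx : IsSMulRegular (R ⧸ J) x) :
    ∃ g : (R ⧸ J) →ₗ[R] (R ⧸ (J ⊔ Ideal.span {x})),
      Function.Exact (x • (LinearMap.id : (R ⧸ J) →ₗ[R] (R ⧸ J))) g ∧
      Function.Injective (x • (LinearMap.id : (R ⧸ J) →ₗ[R] (R ⧸ J))) ∧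
      Function.Surjective g := by
  refine ⟨Submodule.factor le_sup_left, ?_, fun a b hab => hx hab, Submodule.factor_surjective _⟩
  intro y
  obtain ⟨y, rfl⟩ := Submodule.mkQ_surjective _ y
  have : Submodule.factor (le_sup_left : J ≤ J ⊔ Ideal.span {x}) (J.mkQ y) = 0 ↔
    y ∈ J ⊔ Ideal.span {x} := Submodule.Quotient.mk_eq_zero _
  rw [this]
  constructor
  · intro h
    obtain ⟨j, hj, z, hz, rfl⟩ := Submodule.mem_sup.1 h
    obtain ⟨w, rfl⟩ := Ideal.mem_span_singleton'.1 hz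
    refine ⟨J.mkQ w, ?_⟩
    rw [map_add, (Submodule.Quotient.mk_eq_zero J).2 hj |> (fun h => (h : J.mkQ j = 0)), zero_add,
      mul_comm, ← smul_eq_mul, map_smul]
    rfl
  · rintro ⟨w, hw⟩
    obtain ⟨w, rfl⟩ := Submodule.mkQ_surjective _ w
    have h1 : J.mkQ (x * w) = J.mkQ y := hw
    have h2 : y - x * w ∈ J := (Submodule.Quotient.eq J).1 h1.symm
    have h3 : y = (y - x * w) + x * w := by ring
    rw [h3]
    exact add_mem (Ideal.mem_sup_left h2)
      (Ideal.mem_sup_right (Ideal.mul_mem_right _ _ (Ideal.mem_span_singleton_self x)))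

lemma EV.of_primes [IsNoetherianRing R] {X : Type u} [AddCommGroup X] [Module R X] {t : ℕ}
    (J : Ideal R) (h : ∀ q : Ideal R, q.IsPrime → J ≤ q → EV R (R ⧸ q) X t) (N : Type u)
    [AddCommGroup N] [Module R N] [hN : Module.Finite R N] (hJ : ∀ j ∈ J, ∀ y : N, j • y = 0) :
    EV R N X t := by
  revert hJ
  induction hN using IsNoetherianRing.induction_on_isQuotientEquivQuotientPrime R with
  | subsingleton N => exact fun _ => EV.of_subsingleton t
  | quotient N p e =>
    intro hJ
    refine EV.congr e.symm (h p.1 p.2 fun j hj => ?_)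
    have h1 : e (j • e.symm (Ideal.Quotient.mk p.1 1)) = 0 := by rw [hJ j hj, map_zero]
    rw [map_smul, LinearEquiv.apply_symm_apply] at h1
    have h2 : Ideal.Quotient.mk p.1 (j * 1) = 0 := h1
    rwa [mul_one, Ideal.Quotient.eq_zero_iff_mem] at h2
  | exact N₁ N₂ N₃ f g hf hg hfg h₁ h₃ =>
    intro hJ
    refine EV.mid hfg hf hg (h₁ fun j hj y => hf ?_) (h₃ fun j hj y => ?_)
    · rw [map_smul, hJ j hj, map_zero]
    · obtain ⟨y, rfl⟩ := hg y
      rw [← map_smul, hJ j hj, map_zero]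

lemma EV.prime_of_residue [IsNoetherianRing R] [IsLocalRing R] {X : Type u} [AddCommGroup X]
    [Module R X] [Module.Finite R X] {s : ℕ}
    (h : ∀ t : ℕ, s ≤ t → (t : ℕ∞) ≤ s + (IsLocalRing.maximalIdeal R).height →
      EV R (R ⧸ IsLocalRing.maximalIdeal R) X t) (p : Ideal R) :
    p.IsPrime → ∀ t : ℕ, s ≤ t → (t : ℕ∞) ≤ s + p.height → EV R (R ⧸ p) X t := by
  induction p using WellFoundedGT.induction with
  | ind p ih =>
    intro hp t hst htp
    by_cases hpm : p = IsLocalRing.maximalIdeal R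
    · subst hpm; exact h t hst htp
    have hlt : p < IsLocalRing.maximalIdeal R :=
      lt_of_le_of_ne (IsLocalRing.le_maximalIdeal hp.ne_top) hpm
    obtain ⟨x, hxm, hxp⟩ := SetLike.exists_of_lt hlt
    have hreg : IsSMulRegular (R ⧸ p) x := by
      intro a b hab
      have hx0 : Ideal.Quotient.mk p x ≠ 0 := by rwa [Ne, Ideal.Quotient.eq_zero_iff_mem]
      refine mul_left_cancel₀ hx0 ?_
      have h1 : ∀ a : R ⧸ p, x • a = Ideal.Quotient.mk p x * a := fun a => by
        rw [Algebra.smul_def]; rfl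
      rw [← h1, ← h1]
      exact hab
    obtain ⟨g, h1, h2, h3⟩ := mulSeq p x hreg
    refine EV.nakayama hxm h1 h2 h3 (EV.of_primes (p ⊔ Ideal.span {x}) ?_ _ ?_)
    · intro q hq hpq
      have hlt : p < q := lt_of_le_of_ne (le_sup_left.trans hpq) fun h => hxp
        (h ▸ hpq (Ideal.mem_sup_right (Ideal.mem_span_singleton_self x)))
      refine ih q hlt hq (t + 1) (by omega) ?_
      have := Ideal.height_add_one_le_of_lt_of_isPrime hlt
      calc ((t + 1 : ℕ) : ℕ∞) = t + 1 := by push_cast; rfl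
        _ ≤ s + p.height + 1 := by gcongr
        _ = s + (p.height + 1) := add_assoc _ _ _
        _ ≤ _ := by gcongr
    · intro j hj y
      obtain ⟨y, rfl⟩ := Ideal.Quotient.mk_surjective y
      refine (Submodule.Quotient.mk_eq_zero _).2 ?_
      exact Ideal.mul_mem_right _ _ hj

lemma injLT_of_residue [IsNoetherianRing R] [IsLocalRing R] {X : Type u} [AddCommGroup X]
    [Module R X] [Module.Finite R X] {s : ℕ}
    (h : ∀ t : ℕ, s + 1 ≤ t → t ≤ s + 1 + (IsLocalRing.maximalIdeal R).height.toNat →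
      EV R (R ⧸ IsLocalRing.maximalIdeal R) X t) :
    HasInjectiveDimensionLT (ModuleCat.of R X) (s + 1) := by
  refine injLT_of_cyclic s _ fun J e => ?_
  have hfin : (IsLocalRing.maximalIdeal R).height ≠ ⊤ := Ideal.height_ne_top_of_isPrime
  refine EV.of_primes (t := s + 1) (⊥ : Ideal R) (fun q hq _ => ?_) (R ⧸ J) ?_ e
  · refine EV.prime_of_residue (s := s + 1) (fun t h1 h2 => h t h1 ?_) q hq (s + 1) le_rfl ?_
    · rw [← ENat.natCast_toNat hfin] at h2
      exact_mod_cast h2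
    · exact le_self_add
  · intro j hj y
    rw [(Ideal.mem_bot).1 hj, zero_smul]

end InjBound

section Uniform

open Abelian

variable {R : Type u} [CommRing R] [IsNoetherianRing R] [IsLocalRing R]

/-- Projective dimension of `R/J` at most `b`, in terms of vanishing of `Ext`. -/
def PDB (J : Ideal R) (b : ℕ) : Prop :=
  ∀ (X : Type u) [AddCommGroup X] [Module R X] (t : ℕ), b < t → EV R (R ⧸ J) X t

variable (R) in
lemma exists_embedding : ∃ (J : Ideal R) (b : ℕ) (f : (R ⧸ IsLocalRing.maximalIdeal R) →ₗ[R] R ⧸ J),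
    PDB J b ∧ Function.Injective f := by
  have hne : {J : Ideal R | J ≠ ⊤ ∧ ∃ b, PDB J b}.Nonempty := by
    refine ⟨⊥, bot_ne_top, 0, fun X _ _ t ht => ?_⟩
    obtain ⟨t, rfl⟩ := Nat.exists_eq_succ_of_ne_zero ht.ne'
    exact EV.congr (Submodule.quotEquivOfEqBot ⊥ rfl).symm (EV.of_projective t)
  obtain ⟨J, ⟨hJ, b, hb⟩, hmax⟩ := set_has_maximal_iff_noetherian.2
    (inferInstance : IsNoetherian R R) _ hne
  suffices h : IsLocalRing.maximalIdeal R ∈ associatedPrimes R (R ⧸ J) by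
    rw [AssociatedPrimes.mem_iff, isAssociatedPrime_iff] at h
    obtain ⟨-, y, hy⟩ := h
    have hk : IsLocalRing.maximalIdeal R = LinearMap.ker (LinearMap.toSpanSingleton R (R ⧸ J) y) := by
      ext r
      rw [hy, Submodule.mem_colon_singleton]
      simp
    refine ⟨J, b, (IsLocalRing.maximalIdeal R).liftQ _ hk.le, hb, ?_⟩
    rw [← LinearMap.ker_eq_bot, Submodule.ker_liftQ_eq_bot]
    exact hk.ge
  by_contra hn
  have hav : ¬ ((IsLocalRing.maximalIdeal R : Set R) ⊆
      ⋃ p ∈ associatedPrimes R (R ⧸ J), (p : Set R)) := by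
    intro hsub
    obtain ⟨P, hP, hle⟩ := ((IsLocalRing.maximalIdeal R).subset_union_prime_finite
      (associatedPrimes.finite R (R ⧸ J)) (f := id) 0 0 fun _ h _ _ => h.1).1 hsub
    have := (IsLocalRing.maximalIdeal.isMaximal R).eq_of_le hP.isPrime.ne_top hle
    exact hn (this ▸ hP)
  rw [biUnion_associatedPrimes_eq_zero_divisors, Set.not_subset] at hav
  obtain ⟨x, hxm, hx⟩ := hav
  have hreg : IsSMulRegular (R ⧸ J) x := by
    intro y z hyz
    by_contra hne
    refine hx ⟨y - z, sub_ne_zero.2 hne, ?_⟩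
    rw [smul_sub, sub_eq_zero]
    exact hyz
  have hxJ : x ∉ J := by
    intro hxJ
    have : Nontrivial (R ⧸ J) := Ideal.Quotient.nontrivial_iff.2 hJ
    refine hx ⟨1, one_ne_zero, ?_⟩
    refine (Submodule.Quotient.mk_eq_zero J).2 ?_
    exact Ideal.mul_mem_right _ _ hxJ
  obtain ⟨g, h1, h2, h3⟩ := mulSeq J x hreg
  refine hmax (J ⊔ Ideal.span {x}) ⟨?_, b + 1, ?_⟩ ?_
  · refine ne_top_of_le_ne_top (IsLocalRing.maximalIdeal.isMaximal R).ne_top (sup_le ?_ ?_)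
    · exact IsLocalRing.le_maximalIdeal hJ
    · rwa [Ideal.span_singleton_le_iff_mem]
  · intro X _ _ t ht
    obtain ⟨t, rfl⟩ := Nat.exists_eq_succ_of_ne_zero (by omega : t ≠ 0)
    exact EV.right h1 h2 h3 (hb X t (by omega)) (hb X (t + 1) (by omega))
  · refine lt_of_le_of_ne le_sup_left fun h => hxJ ?_
    rw [h]
    exact Ideal.mem_sup_right (Ideal.mem_span_singleton_self x)

variable (R) in
lemma exists_uniform : ∃ b : ℕ, ∀ (X : Type u) [AddCommGroup X] [Module R X] [Module.Finite R X]
    (a : ℕ), HasInjectiveDimensionLT (ModuleCat.of R X) a →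
      HasInjectiveDimensionLT (ModuleCat.of R X) (b + 1) := by
  obtain ⟨J, b, f, hb, hf⟩ := exists_embedding R
  refine ⟨b, fun X _ _ _ a ha => ?_⟩
  have key : ∀ j, HasInjectiveDimensionLT (ModuleCat.of R X) (b + 1 + j) →
      HasInjectiveDimensionLT (ModuleCat.of R X) (b + 1) := by
    intro j
    induction j with
    | zero => exact id
    | succ j ih =>
      intro h
      apply ih
      have e : b + 1 + j = (b + j) + 1 := by omega
      rw [e]
      refine injLT_of_residue fun t ht _ => ?_
      rcases ht.eq_or_lt with rfl | ht
      · refine EV.left (LinearMap.exact_map_mkQ_range f) hf (Submodule.mkQ_surjective _)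
          (hb X _ (by omega)) (EV.of_injLT h (by omega))
      · exact EV.of_injLT h (by omega)
  refine key a ?_
  exact hasInjectiveDimensionLT_of_ge _ a _ (by omega)

variable (R) in
lemma exists_range : ∃ c : ℕ, ∀ (X X' : Type u) [AddCommGroup X] [Module R X] [Module.Finite R X]
    [AddCommGroup X'] [Module R X'] [Module.Finite R X'],
    (∀ t < c, EV R (R ⧸ IsLocalRing.maximalIdeal R) X (t + 1) ↔
      EV R (R ⧸ IsLocalRing.maximalIdeal R) X' (t + 1)) → injDim R X = injDim R X' := by
  obtain ⟨b, hb⟩ := exists_uniform R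
  have key : ∀ (X X' : Type u) [AddCommGroup X] [Module R X] [Module.Finite R X]
      [AddCommGroup X'] [Module R X'] [Module.Finite R X'],
    (∀ t < b + 1 + (IsLocalRing.maximalIdeal R).height.toNat,
      EV R (R ⧸ IsLocalRing.maximalIdeal R) X (t + 1) ↔
      EV R (R ⧸ IsLocalRing.maximalIdeal R) X' (t + 1)) → ∀ m,
      HasInjectiveDimensionLT (ModuleCat.of R X) (m + 1) →
      HasInjectiveDimensionLT (ModuleCat.of R X') (m + 1) := by
    intro X X' _ _ _ _ _ _ h
    have hsmall : ∀ m ≤ b, HasInjectiveDimensionLT (ModuleCat.of R X) (m + 1) →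
        HasInjectiveDimensionLT (ModuleCat.of R X') (m + 1) := by
      intro m hm hX
      refine injLT_of_residue fun t ht ht' => ?_
      obtain ⟨t, rfl⟩ := Nat.exists_eq_succ_of_ne_zero (by omega : t ≠ 0)
      exact (h t (by omega)).1 (EV.of_injLT hX ht)
    intro m hX
    rcases le_total m b with hm | hm
    · exact hsmall m hm hX
    · have := hsmall b le_rfl (hb X _ hX)
      exact hasInjectiveDimensionLT_of_ge _ (b + 1) _ (by omega)
  refine ⟨_, fun X X' _ _ _ _ _ _ h => injDim_eq_of_iff fun m => ⟨key X X' h m, ?_⟩⟩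
  exact key X' X (fun t ht => (h t ht).symm) m

end Uniform

/-- over a Noetherian local ring, `id_R(F(M/IⁿN))` is eventually
constant. -/
theorem stmt14 {R : Type u} [CommRing R] [IsNoetherianRing R] [IsLocalRing R]
    {r : ℕ} (hr : 1 ≤ r) (I : Fin r → Ideal R)
    (M : Type u) [AddCommGroup M] [Module R M] [Module.Finite R M]
    (N : Submodule R M)
    {K L : Type u} [AddCommGroup K] [Module R K] [Module.Finite R K]
    [AddCommGroup L] [Module R L] [Module.Finite R L]
    (f : K →ₗ[R] L) :
    ∃ c : Fin r → ℕ, ∀ n : Fin r → ℕ, c ≤ n →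
      injDim R (coherentApply f (M ⧸ (prodPow I n • N : Submodule R M))) =
      injDim R (coherentApply f (M ⧸ (prodPow I c • N : Submodule R M))) := by
  obtain ⟨d, hd⟩ := exists_range R
  have hX := (ARMod.quot I M N).coherent f
  have hev : ∀ t : ℕ,
      (∀ᶠ n in Filter.atTop, EV R (R ⧸ IsLocalRing.maximalIdeal R)
        (coherentApply f (M ⧸ (prodPow I n • N : Submodule R M))) (t + 1)) ∨
      (∀ᶠ n in Filter.atTop, ¬ EV R (R ⧸ IsLocalRing.maximalIdeal R)
        (coherentApply f (M ⧸ (prodPow I n • N : Submodule R M))) (t + 1)) := by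
    intro t
    obtain ⟨K', L', _, _, _, _, _, _, f', hf'⟩ :=
      ev_iff_coherent (R := R) t (R ⧸ IsLocalRing.maximalIdeal R)
    simp only [hf']
    exact (hX.coherent f').subsingleton_eventually
  have hstab : ∀ t : ℕ, ∃ c : Fin r → ℕ, ∀ n, c ≤ n → ∀ n', c ≤ n' →
      (EV R (R ⧸ IsLocalRing.maximalIdeal R)
        (coherentApply f (M ⧸ (prodPow I n • N : Submodule R M))) (t + 1) ↔
      EV R (R ⧸ IsLocalRing.maximalIdeal R)
        (coherentApply f (M ⧸ (prodPow I n' • N : Submodule R M))) (t + 1)) := by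
    intro t
    rcases hev t with h | h
    · obtain ⟨c, hc⟩ := Filter.eventually_atTop.1 h
      exact ⟨c, fun n hn n' hn' => iff_of_true (hc n hn) (hc n' hn')⟩
    · obtain ⟨c, hc⟩ := Filter.eventually_atTop.1 h
      exact ⟨c, fun n hn n' hn' => iff_of_false (hc n hn) (hc n' hn')⟩
  choose c hc using hstab
  refine ⟨(Finset.range d).sup c, fun n hn => hd _ _ fun t ht => ?_⟩
  have hle : c t ≤ (Finset.range d).sup c := Finset.le_sup (Finset.mem_range.2 ht)
  exact hc t n (hle.trans hn) _ hle
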